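/- For all integers τ, κ ≥ 0, there exist integers m, c ≥ 0 with the following property. Let G be a graph such that ω(G) ≤ κ, every induced subgraph H of G with ω(H) < κ has χ(H) ≤ τ, and G admits a stable multicover (N_x : x ∈ X) of a set C with |X| = m and χ(C) > c. Then there are three oddities P_1, P_2, P_3 for the multicover, such that V(P_1), V(P_2), V(P_3) are pairwise anticomplete. -/

import Mathlib

open SimpleGraph

variable {V : Type*}

/-- Sets `A`, `B` are anticomplete: disjoint, with no edges between them. -/
def Anticomplete (G : SimpleGraph V) (A B : Set V) : Prop :=
  Disjoint A B ∧ ∀ a ∈ A, ∀ b ∈ B, ¬ G.Adj a b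

/-- `B` covers `C`: they are disjoint and every vertex of `C` has a neighbour in `B`. -/
def Covers (G : SimpleGraph V) (B C : Set V) : Prop :=
  Disjoint B C ∧ ∀ v ∈ C, ∃ b ∈ B, G.Adj b v

/-- `(x, N)` is a cover of `C`. -/
def IsCover (G : SimpleGraph V) (x : V) (N C : Set V) : Prop :=
  (∀ u ∈ N, G.Adj x u) ∧ x ∉ C ∧ (∀ u ∈ C, ¬ G.Adj x u) ∧ Covers G N C

/-- `S` is a stable set of `G`. -/
def StableSet (G : SimpleGraph V) (S : Set V) : Prop :=
  ∀ u ∈ S, ∀ v ∈ S, ¬ G.Adj u v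

/-- `(N x : x ∈ X)` is a multicover of `C` in `G`. -/
def IsMulticover (G : SimpleGraph V) (X : Finset V) (N : V → Set V) (C : Set V) : Prop :=
  StableSet G ↑X ∧
  (∀ x ∈ X, IsCover G x (N x) C) ∧
  (∀ x ∈ X, ∀ y ∈ X, x ≠ y → y ∉ N x ∧ ∀ u ∈ N x, ¬ G.Adj y u)

/-- A multicover is stable if each of the sets `N x` is stable. -/
def IsStableMulticover (G : SimpleGraph V) (X : Finset V) (N : V → Set V) (C : Set V) : Prop :=
  IsMulticover G X N C ∧ ∀ x ∈ X, StableSet G (N x)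

/-- `f` describes an oddity for the multicover `(N x : x ∈ X)` of `C`. -/
def IsOddity (G : SimpleGraph V) (X : Finset V) (N : V → Set V) (C : Set V)
    {k : ℕ} (f : pathGraph (k + 1) ↪g G) : Prop :=
  (k = 3 ∨ k = 5) ∧
  f 0 ∈ X ∧ f (Fin.last k) ∈ X ∧
  (∀ x ∈ X, x ≠ f 0 → x ≠ f (Fin.last k) →
    x ∉ Set.range f ∧ ∀ u ∈ Set.range f, ¬ G.Adj x u) ∧
  Set.range f ⊆ (↑X : Set V) ∪ (⋃ x ∈ X, N x) ∪ C

/-- A symmetric zero-sum game has a mixed strategy that guarantees a nonnegative payoff. -/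
theorem exists_optimal_strategy {ι : Type*} [Fintype ι] [Nonempty ι] (M : ι → ι → ℝ)
    (hM : ∀ i j, M i j = -M j i) :
    ∃ w : ι → ℝ, (∀ i, 0 ≤ w i) ∧ ∑ i, w i = 1 ∧ ∀ j, 0 ≤ ∑ i, w i * M i j := by
  classical
  by_contra! hcon
  let L : (ι → ℝ) →ₗ[ℝ] (ι → ℝ) := Matrix.vecMulLinear (Matrix.of M)
  have hL : ∀ w j, L w j = ∑ i, w i * M i j := fun w j => rfl
  have hdisj : Disjoint (L '' stdSimplex ℝ ι) (Set.Ici (0 : ι → ℝ)) := by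
    rw [Set.disjoint_left]
    rintro _ ⟨w, ⟨hw0, hw1⟩, rfl⟩ hmem
    obtain ⟨j, hj⟩ := hcon w hw0 hw1
    exact absurd (hmem j) (not_le.2 (by simpa [hL] using hj))
  obtain ⟨f, u, v, hu, huv, hv⟩ := geometric_hahn_banach_compact_closed
    ((convex_stdSimplex ℝ ι).linear_image L)
    ((isCompact_stdSimplex ℝ ι).image (LinearMap.continuous_of_finiteDimensional L))
    (convex_Ici _) isClosed_Ici hdisj
  have hv0 : v < 0 := by simpa using hv 0 (Set.mem_Ici.2 le_rfl)
  let y : ι → ℝ := fun i => f (Pi.single i 1)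
  have hf : ∀ a : ι → ℝ, f a = ∑ i, a i * y i := by
    intro a
    conv_lhs => rw [pi_eq_sum_univ' a]
    simp [y, map_sum]
  have hy : ∀ i, 0 ≤ y i := by
    intro i
    by_contra! hi
    have hpos : 0 ≤ v / y i := div_nonneg_of_nonpos hv0.le hi.le
    have h := hv (Pi.single i (v / y i)) (by
      intro j
      by_cases hij : j = i
      · subst hij; simpa using hpos
      · simp [hij])
    rw [hf, Finset.sum_eq_single i (by intro b _ hb; simp [hb]) (by simp)] at h
    simp only [Pi.single_eq_same] at h
    rw [div_mul_cancel₀ _ hi.ne] at h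
    exact lt_irrefl _ h
  have hsum : 0 < ∑ i, y i := by
    rcases (Finset.sum_nonneg fun i (_ : i ∈ Finset.univ) => hy i).lt_or_eq with h | h
    · exact h
    · exfalso
      have hz : ∀ i, y i = 0 := fun i =>
        (Finset.sum_eq_zero_iff_of_nonneg fun i _ => hy i).1 h.symm i (Finset.mem_univ i)
      have hmem : L (Pi.single (Classical.arbitrary ι) 1) ∈ L '' stdSimplex ℝ ι :=
        ⟨_, single_mem_stdSimplex ℝ _, rfl⟩
      have := hu _ hmem
      rw [hf] at this
      simp only [hz, mul_zero, Finset.sum_const_zero] at this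
      linarith
  have hskew : ∑ j, (∑ i, y i * M i j) * y j = 0 := by
    have h1 : ∑ j, (∑ i, y i * M i j) * y j = -∑ j, (∑ i, y i * M i j) * y j := by
      simp only [Finset.sum_mul]
      rw [← Finset.sum_neg_distrib, Finset.sum_comm]
      refine Finset.sum_congr rfl fun i _ => ?_
      rw [← Finset.sum_neg_distrib]
      refine Finset.sum_congr rfl fun j _ => ?_
      rw [hM i j]; ring
    linarith
  have hmem : L ((∑ i, y i)⁻¹ • y) ∈ L '' stdSimplex ℝ ι := by
    refine ⟨_, ⟨fun i => mul_nonneg (inv_nonneg.2 hsum.le) (hy i), ?_⟩, rfl⟩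
    rw [← Finset.mul_sum]
    exact inv_mul_cancel₀ hsum.ne'
  have := hu _ hmem
  rw [map_smul, map_smul, hf] at this
  simp only [hL, hskew, smul_zero] at this
  linarith

/-- Given rankings `r z` of a finite type, one for each `z ∈ X`, boundedly many elements suffice for
every element to be matched or beaten by one of them in at least `q` of the rankings. -/
theorem exists_dominating_finset {ι α : Type*} [Fintype ι] [Nonempty ι] (X : Finset α) (q : ℕ)
    (hX : 16 * q ≤ X.card) (r : α → ι → ℕ) :
    ∃ F : Finset ι, F.card ≤ 2 ^ X.card ∧
      ∀ j, ∃ i ∈ F, q ≤ (X.filter fun z => r z i ≤ r z j).card := by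
  classical
  let e : α → ι → ι → ℝ := fun z i j => if r z i ≤ r z j then 1 else 0
  obtain ⟨w, hw0, hw1, hw⟩ := exists_optimal_strategy
    (fun i j => ∑ z ∈ X, (e z i j - e z j i)) (by
      intro i j
      rw [← Finset.sum_neg_distrib]
      exact Finset.sum_congr rfl fun z _ => by ring)
  let Q : α → ι → ℝ := fun z j => ∑ i, w i * e z i j
  have hQle : ∀ z j, Q z j ≤ 1 := by
    intro z j
    rw [← hw1]
    refine Finset.sum_le_sum fun i _ => mul_le_of_le_one_right (hw0 i) ?_
    simp only [e]; split_ifs <;> norm_num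
  have hQ : ∀ j, (X.card : ℝ) / 2 ≤ ∑ z ∈ X, Q z j := by
    intro j
    have h1 : ∑ i, w i * ∑ z ∈ X, (e z i j - e z j i) ≤
        ∑ i, w i * ∑ z ∈ X, (2 * e z i j - 1) := by
      refine Finset.sum_le_sum fun i _ => mul_le_mul_of_nonneg_left ?_ (hw0 i)
      refine Finset.sum_le_sum fun z _ => ?_
      simp only [e]
      split_ifs <;> first | omega | norm_num
    have h2 : ∑ i, w i * ∑ z ∈ X, (2 * e z i j - 1) = 2 * ∑ z ∈ X, Q z j - X.card := by
      simp only [Q, Finset.sum_sub_distrib, mul_sub, Finset.mul_sum]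
      rw [Finset.sum_comm]
      simp only [Finset.sum_const, nsmul_eq_mul, mul_one, ← Finset.mul_sum, hw1]
      congr 1
      simp only [Finset.mul_sum]
      exact Finset.sum_congr rfl fun z _ => Finset.sum_congr rfl fun i _ => by ring
    have := (hw j).trans h1
    rw [h2] at this
    linarith
  let S : α → ι → Prop := fun z i => ∀ j, 1 / 4 ≤ Q z j → r z i ≤ r z j
  have hS : ∀ z, 1 / 4 ≤ ∑ i, w i * (if S z i then 1 else 0) := by
    intro z
    by_cases hne : ∃ j, 1 / 4 ≤ Q z j
    · obtain ⟨j, hj, hmin⟩ := Set.exists_min_image {j | 1 / 4 ≤ Q z j} (r z) (Set.toFinite _) hne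
      refine hj.trans (Finset.sum_le_sum fun i _ => mul_le_mul_of_nonneg_left ?_ (hw0 i))
      by_cases hij : r z i ≤ r z j
      · have : S z i := fun k hk => hij.trans (hmin k hk)
        simp [e, hij, this]
      · simp only [e, hij, if_false]
        split_ifs <;> norm_num
    · have : ∀ i, S z i := fun i j hj => absurd ⟨j, hj⟩ hne
      simp only [this, if_true, mul_one, hw1]
      norm_num
  have hpick : ∀ Z : Finset α, ∃ i, 4 * q ≤ Z.card → q ≤ (Z.filter fun z => S z i).card := by
    intro Z
    by_contra! hcon
    have hZ := (hcon (Classical.arbitrary ι)).1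
    have h1 : (Z.card : ℝ) / 4 ≤ ∑ z ∈ Z, ∑ i, w i * (if S z i then 1 else 0) := by
      have := Finset.card_nsmul_le_sum Z _ (1 / 4 : ℝ) fun z _ => hS z
      rw [nsmul_eq_mul] at this
      linarith
    rw [Finset.sum_comm] at h1
    have h2 : ∀ i, ∑ z ∈ Z, w i * (if S z i then (1 : ℝ) else 0) =
        w i * ((Z.filter fun z => S z i).card : ℝ) := by
      intro i
      rw [← Finset.mul_sum, Finset.sum_boole]
    simp only [h2] at h1
    have hq : 0 < q := lt_of_le_of_lt (Nat.zero_le _) (hcon (Classical.arbitrary ι)).2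
    have h3 : ∑ i, w i * ((Z.filter fun z => S z i).card : ℝ) ≤ ∑ i, w i * ((q : ℝ) - 1) := by
      refine Finset.sum_le_sum fun i _ => mul_le_mul_of_nonneg_left ?_ (hw0 i)
      have : (Z.filter fun z => S z i).card + 1 ≤ q := (hcon i).2
      have : ((Z.filter fun z => S z i).card : ℝ) + 1 ≤ q := by exact_mod_cast this
      linarith
    rw [← Finset.sum_mul, hw1, one_mul] at h3
    have : (4 : ℝ) * q ≤ Z.card := by exact_mod_cast hZ
    linarith
  choose p hp using hpick
  refine ⟨X.powerset.image p, Finset.card_image_le.trans (Finset.card_powerset X).le, fun j => ?_⟩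
  let Z := X.filter fun z => 1 / 4 ≤ Q z j
  have hZ : 4 * q ≤ Z.card := by
    have h1 : ∑ z ∈ X, Q z j ≤ ∑ z ∈ X, ((if 1 / 4 ≤ Q z j then 1 else 0) + 1 / 4) := by
      refine Finset.sum_le_sum fun z _ => ?_
      split_ifs with h
      · linarith [hQle z j]
      · linarith
    rw [Finset.sum_add_distrib, Finset.sum_boole, Finset.sum_const, nsmul_eq_mul] at h1
    have h2 : (16 : ℝ) * q ≤ X.card := by exact_mod_cast hX
    have h3 : (4 : ℝ) * q ≤ Z.card := by
      have := hQ j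
      simp only [Z]
      linarith
    exact_mod_cast h3
  refine ⟨p Z, Finset.mem_image_of_mem _ (Finset.mem_powerset.2 (Finset.filter_subset _ _)),
    (hp Z hZ).trans (Finset.card_le_card fun z hz => ?_)⟩
  obtain ⟨hzZ, hzS⟩ := Finset.mem_filter.1 hz
  obtain ⟨hzX, hzQ⟩ := Finset.mem_filter.1 hzZ
  exact Finset.mem_filter.2 ⟨hzX, hzS j hzQ⟩

/-- `G[S]` is `n`-colourable. -/
def ColorableOn (G : SimpleGraph V) (S : Set V) (n : ℕ) : Prop :=
  ∃ f : V → ℕ, (∀ v ∈ S, f v < n) ∧ ∀ u ∈ S, ∀ v ∈ S, G.Adj u v → f u ≠ f v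

theorem colorableOn_iff {G : SimpleGraph V} {S : Set V} {n : ℕ} :
    ColorableOn G S n ↔ (G.induce S).Colorable n := by
  classical
  constructor
  · rintro ⟨f, hf, hadj⟩
    exact ⟨Coloring.mk (fun v => ⟨f v, hf v v.2⟩) fun {u v} h heq =>
      hadj u u.2 v v.2 h (Fin.mk.inj_iff.1 heq)⟩
  · rintro ⟨f⟩
    refine ⟨fun v => if h : v ∈ S then (f ⟨v, h⟩ : ℕ) else 0, fun v hv => ?_,
      fun u hu v hv h heq => ?_⟩
    · simp [hv]
    · simp only [hu, hv, dif_pos] at heq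
      exact f.valid (v := ⟨u, hu⟩) (w := ⟨v, hv⟩) h (Fin.ext heq)

namespace ColorableOn

variable {G : SimpleGraph V}

theorem mono {S T : Set V} {a b : ℕ} (h : ColorableOn G T a) (hST : S ⊆ T) (hab : a ≤ b) :
    ColorableOn G S b := by
  obtain ⟨f, hf, hadj⟩ := h
  exact ⟨f, fun v hv => (hf v (hST hv)).trans_le hab,
    fun u hu v hv => hadj u (hST hu) v (hST hv)⟩

theorem union {S T : Set V} {a b : ℕ} (hS : ColorableOn G S a) (hT : ColorableOn G T b) :
    ColorableOn G (S ∪ T) (a + b) := by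
  classical
  obtain ⟨f, hf, hfadj⟩ := hS
  obtain ⟨g, hg, hgadj⟩ := hT
  refine ⟨fun v => if v ∈ S then f v else a + g v, fun v hv => ?_, fun u hu v hv h => ?_⟩
  · by_cases hvS : v ∈ S
    · simp only [hvS, if_true]; exact Nat.lt_add_right _ (hf v hvS)
    · simp only [hvS, if_false]; exact Nat.add_lt_add_left (hg v (hv.resolve_left hvS)) a
  · by_cases huS : u ∈ S <;> by_cases hvS : v ∈ S <;> simp only [huS, hvS, if_true, if_false]
    · exact hfadj u huS v hvS h
    · have := hf u huS; omega
    · have := hf v hvS; omega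
    · have := hgadj u (hu.resolve_left huS) v (hv.resolve_left hvS) h; omega

theorem biUnion {ι : Type*} {s : Finset ι} {S : ι → Set V} {a : ℕ}
    (h : ∀ i ∈ s, ColorableOn G (S i) a) : ColorableOn G (⋃ i ∈ s, S i) (s.card * a) := by
  classical
  induction s using Finset.induction_on with
  | empty => exact ⟨fun _ => 0, by simp, by simp⟩
  | insert i s hi ih =>
    rw [Finset.set_biUnion_insert, Finset.card_insert_of_notMem hi]
    exact ((h i (Finset.mem_insert_self i s)).union
      (ih fun j hj => h j (Finset.mem_insert_of_mem hj))).mono subset_rfl (by ring_nf; rfl)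

theorem exists_fiber {ι : Type*} {s : Finset ι} {S : Set V} {a : ℕ} (t : V → ι)
    (ht : ∀ v ∈ S, t v ∈ s) (h : ¬ColorableOn G S (s.card * a)) :
    ∃ i ∈ s, ¬ColorableOn G {v ∈ S | t v = i} a := by
  by_contra! hcon
  refine h ((biUnion hcon).mono (fun v hv => ?_) le_rfl)
  exact Set.mem_biUnion (ht v hv) ⟨hv, rfl⟩

theorem diff {S T : Set V} {a b : ℕ} (hT : ColorableOn G T b) (h : ¬ColorableOn G S (a + b)) :
    ¬ColorableOn G (S \ T) a := fun hd =>
  h ((hd.union hT).mono (fun v hv => by by_cases hvT : v ∈ T <;> simp [hv, hvT]) le_rfl)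

end ColorableOn

/-- `G` has no clique on `κ + 1` vertices, and every set of vertices including no clique on `κ`
vertices is `τ`-colourable. -/
def CliqueControlled (G : SimpleGraph V) (κ τ : ℕ) : Prop :=
  G.CliqueFree (κ + 1) ∧
    ∀ Y : Set V, (∀ K : Finset V, ↑K ⊆ Y → ¬G.IsNClique κ K) → ColorableOn G Y τ

namespace CliqueControlled

variable {G : SimpleGraph V} {κ τ : ℕ}

theorem not_forall_adj (hG : CliqueControlled G κ τ) {K : Finset V} (hK : G.IsNClique κ K)
    (v : V) : ¬∀ u ∈ K, G.Adj v u := by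
  classical
  exact fun h => hG.1 _ (hK.insert h)

theorem colorableOn_neighborSet (hG : CliqueControlled G κ τ) (v : V) :
    ColorableOn G (G.neighborSet v) τ :=
  hG.2 _ fun _ hKv hK => hG.not_forall_adj hK v fun _ hu => hKv hu

theorem exists_isNClique (hG : CliqueControlled G κ τ) {S : Set V} (hS : ¬ColorableOn G S τ) :
    ∃ K : Finset V, ↑K ⊆ S ∧ G.IsNClique κ K := by
  by_contra! h
  exact hS (hG.2 S h)

theorem nonempty_of_isNClique [Nonempty V] (hG : CliqueControlled G κ τ) {K : Finset V}
    (hK : G.IsNClique κ K) : K.Nonempty := by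
  rw [Finset.nonempty_iff_ne_empty]
  rintro rfl
  exact hG.not_forall_adj hK (Classical.arbitrary V) (by simp)

theorem of_cliqueNum [Fintype V] (hω : G.cliqueNum ≤ κ)
    (hχ : ∀ Y : Set V, (G.induce Y).cliqueNum < κ →
      (G.induce Y).chromaticNumber ≤ (τ : ℕ∞)) : CliqueControlled G κ τ := by
  classical
  refine ⟨fun K hK => ?_, fun Y hY => ?_⟩
  · have := hK.isClique.card_le_cliqueNum
    rw [hK.card_eq] at this
    omega
  · rw [colorableOn_iff, ← chromaticNumber_le_iff_colorable]
    refine hχ Y ?_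
    by_contra! hle
    obtain ⟨K, hK⟩ := (G.induce Y).exists_isNClique_cliqueNum
    obtain ⟨K', hK'K, hcard⟩ := Finset.exists_subset_card_eq (hK.card_eq ▸ hle)
    have hK' : (G.induce Y).IsNClique κ K' := ⟨hK.isClique.subset hK'K, hcard⟩
    refine hY (K'.map (Function.Embedding.subtype _)) ?_ ?_
    · intro v hv
      obtain ⟨u, _, rfl⟩ := Finset.mem_map.1 (Finset.mem_coe.1 hv)
      exact u.2
    · refine ⟨?_, by simpa using hcard⟩
      intro u hu v hv huv
      obtain ⟨u, hu', rfl⟩ := Finset.mem_map.1 (Finset.mem_coe.1 hu)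
      obtain ⟨v, hv', rfl⟩ := Finset.mem_map.1 (Finset.mem_coe.1 hv)
      exact hK'.isClique hu' hv' fun h => huv (by rw [h])

end CliqueControlled

theorem anticomplete_iff {G : SimpleGraph V} {A B : Set V} :
    Anticomplete G A B ↔ ∀ a ∈ A, ∀ b ∈ B, a ≠ b ∧ ¬G.Adj a b := by
  simp only [Anticomplete, Set.disjoint_iff_forall_ne]
  exact ⟨fun h a ha b hb => ⟨h.1 ha hb, h.2 a ha b hb⟩,
    fun h => ⟨fun a ha b hb => (h a ha b hb).1, fun a ha b hb => (h a ha b hb).2⟩⟩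

theorem Anticomplete.symm {G : SimpleGraph V} {A B : Set V} (h : Anticomplete G A B) :
    Anticomplete G B A :=
  ⟨h.1.symm, fun b hb a ha hba => h.2 a ha b hb hba.symm⟩

namespace IsMulticover

variable {G : SimpleGraph V} {X X' : Finset V} {N N' : V → Set V} {C C' : Set V}

theorem not_adj (hM : IsMulticover G X N C) {x y : V} (hx : x ∈ X) (hy : y ∈ X) : ¬G.Adj x y :=
  hM.1 x hx y hy

theorem adj (hM : IsMulticover G X N C) {x u : V} (hx : x ∈ X) (hu : u ∈ N x) : G.Adj x u :=
  (hM.2.1 x hx).1 u hu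

theorem exists_adj (hM : IsMulticover G X N C) {x c : V} (hx : x ∈ X) (hc : c ∈ C) :
    ∃ u ∈ N x, G.Adj u c :=
  (hM.2.1 x hx).2.2.2.2 c hc

theorem avoids_set (hM : IsMulticover G X N C) {x c : V} (hx : x ∈ X) (hc : c ∈ C) :
    x ≠ c ∧ ¬G.Adj x c :=
  ⟨fun h => (hM.2.1 x hx).2.1 (h ▸ hc), (hM.2.1 x hx).2.2.1 c hc⟩

theorem avoids_neighbors (hM : IsMulticover G X N C) {x y u : V} (hx : x ∈ X) (hy : y ∈ X)
    (hxy : x ≠ y) (hu : u ∈ N y) : x ≠ u ∧ ¬G.Adj x u :=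
  have h := hM.2.2 y hy x hx hxy.symm
  ⟨fun e => h.1 (e ▸ hu), h.2 u hu⟩

theorem neighbors_ne_set (hM : IsMulticover G X N C) {x u c : V} (hx : x ∈ X) (hu : u ∈ N x)
    (hc : c ∈ C) : u ≠ c :=
  Set.disjoint_iff_forall_ne.1 (hM.2.1 x hx).2.2.2.1 hu hc

theorem neighbors_ne (hM : IsMulticover G X N C) {x y u v : V} (hx : x ∈ X) (hy : y ∈ X)
    (hxy : x ≠ y) (hu : u ∈ N x) (hv : v ∈ N y) : u ≠ v := by
  rintro rfl
  exact (hM.avoids_neighbors hx hy hxy hv).2 (hM.adj hx hu)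

theorem restrict (hM : IsMulticover G X N C) (hX : X' ⊆ X) (hN : ∀ x ∈ X', N' x ⊆ N x)
    (hC : C' ⊆ C) (hcov : ∀ x ∈ X', ∀ c ∈ C', ∃ u ∈ N' x, G.Adj u c) :
    IsMulticover G X' N' C' := by
  refine ⟨fun x hx y hy => hM.not_adj (hX hx) (hX hy), fun x hx => ⟨?_, ?_, ?_, ?_, ?_⟩,
    fun x hx y hy hxy => ⟨?_, ?_⟩⟩
  · exact fun u hu => hM.adj (hX hx) (hN x hx hu)
  · exact fun h => (hM.avoids_set (hX hx) (hC h)).1 rfl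
  · exact fun u hu => (hM.avoids_set (hX hx) (hC hu)).2
  · exact Set.disjoint_iff_forall_ne.2 fun u hu c hc =>
      hM.neighbors_ne_set (hX hx) (hN x hx hu) (hC hc)
  · exact hcov x hx
  · exact fun h => (hM.avoids_neighbors (hX hy) (hX hx) hxy.symm (hN x hx h)).1 rfl
  · exact fun u hu => (hM.avoids_neighbors (hX hy) (hX hx) hxy.symm (hN x hx hu)).2

end IsMulticover

theorem exists_embedding_eq_of_adj_iff {G : SimpleGraph V} {k : ℕ} (hk : k = 3 ∨ k = 5)
    (v : Fin (k + 1) → V)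
    (hv : ∀ i j, G.Adj (v i) (v j) ↔ i.val + 1 = j.val ∨ j.val + 1 = i.val) :
    ∃ f : pathGraph (k + 1) ↪g G, ⇑f = v := by
  refine ⟨⟨⟨v, fun i j hij => ?_⟩, fun {i j} => (hv i j).trans pathGraph_adj.symm⟩, rfl⟩
  have htwins : ∀ l : Fin (k + 1), (i.val + 1 = l.val ∨ l.val + 1 = i.val) ↔
      (j.val + 1 = l.val ∨ l.val + 1 = j.val) := fun l => by rw [← hv, ← hv, hij]
  clear hv hij
  rcases hk with rfl | rfl <;> revert i j <;> decide

/-- `P` is the vertex set of an oddity. -/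
def IsOdditySet (G : SimpleGraph V) (X : Finset V) (N : V → Set V) (C P : Set V) : Prop :=
  ∃ (k : ℕ) (f : pathGraph (k + 1) ↪g G), IsOddity G X N C f ∧ Set.range f = P

section OdditySet

variable {G : SimpleGraph V} {X X' : Finset V} {N N' : V → Set V} {C C' P : Set V}

theorem IsOdditySet.subset (h : IsOdditySet G X N C P) : P ⊆ (↑X : Set V) ∪ (⋃ x ∈ X, N x) ∪ C := by
  obtain ⟨k, f, hf, rfl⟩ := h
  exact hf.2.2.2.2

theorem IsOdditySet.mono (h : IsOdditySet G X' N' C' P) (hM : IsMulticover G X N C)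
    (hX : X' ⊆ X) (hN : ∀ x ∈ X', N' x ⊆ N x) (hC : C' ⊆ C) : IsOdditySet G X N C P := by
  obtain ⟨k, f, ⟨hk, h0, hl, hav, hsub⟩, rfl⟩ := h
  refine ⟨k, f, ⟨hk, hX h0, hX hl, fun z hz hz0 hzl => ?_, hsub.trans ?_⟩, rfl⟩
  · by_cases hzX : z ∈ X'
    · exact hav z hzX hz0 hzl
    · have key : ∀ u ∈ Set.range f, z ≠ u ∧ ¬G.Adj z u := by
        intro u hu
        rcases hsub hu with (huX | huN) | huC
        · exact ⟨fun e => hzX (e ▸ huX), hM.not_adj hz (hX huX)⟩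
        · obtain ⟨y, hy, huy⟩ := Set.mem_iUnion₂.1 huN
          exact hM.avoids_neighbors hz (hX hy) (fun e => hzX (e ▸ hy)) (hN y hy huy)
        · exact hM.avoids_set hz (hC huC)
      exact ⟨fun hmem => (key z hmem).1 rfl, fun u hu => (key u hu).2⟩
  · exact Set.union_subset_union (Set.union_subset_union (Finset.coe_subset.2 hX)
      (Set.iUnion₂_subset fun x hx => (hN x hx).trans
        (Set.subset_biUnion_of_mem (u := fun x => N x) (Finset.mem_coe.2 (hX hx))))) hC

theorem IsMulticover.isOdditySet_of_adj (hM : IsMulticover G X N C) {x y a b : V} (hx : x ∈ X)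
    (hy : y ∈ X) (hxy : x ≠ y) (ha : a ∈ N x) (hb : b ∈ N y) (hab : G.Adj a b) :
    IsOdditySet G X N C {x, a, b, y} := by
  have h1 := hM.adj hx ha
  have h2 := hM.adj hy hb
  have h3 := (hM.avoids_neighbors hx hy hxy hb).2
  have h4 := (hM.avoids_neighbors hy hx hxy.symm ha).2
  have h5 := hM.not_adj hx hy
  obtain ⟨f, hf⟩ := exists_embedding_eq_of_adj_iff (G := G) (Or.inl rfl) ![x, a, b, y] (by
    intro i j
    fin_cases i <;> fin_cases j <;> simp [h1, h2, h3, h5, hab, h1.symm, h2.symm, hab.symm,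
      mt G.adj_symm h3, h4, mt G.adj_symm h4, mt G.adj_symm h5])
  have hrange : Set.range f = {x, a, b, y} := by
    rw [hf]; ext; simp [eq_comm]; tauto
  refine ⟨3, f, ⟨Or.inl rfl, ?_, ?_, ?_, ?_⟩, hrange⟩
  · simpa [hf] using hx
  · simpa [hf] using hy
  · intro z hz hz0 hzl
    replace hz0 : z ≠ x := by simpa [hf] using hz0
    replace hzl : z ≠ y := by simpa [hf] using hzl
    have ha' := hM.avoids_neighbors hz hx hz0 ha
    have hb' := hM.avoids_neighbors hz hy hzl hb
    rw [hrange]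
    simp [hz0, hzl, ha', hb', hM.not_adj hz hx, hM.not_adj hz hy]
  · rw [hrange]
    have haU : a ∈ ⋃ x ∈ X, N x := Set.mem_biUnion (t := N) hx ha
    have hbU : b ∈ ⋃ x ∈ X, N x := Set.mem_biUnion (t := N) hy hb
    rintro v (rfl | rfl | rfl | rfl)
    exacts [Or.inl (Or.inl hx), Or.inl (Or.inr haU), Or.inl (Or.inr hbU), Or.inl (Or.inl hy)]

theorem IsMulticover.isOdditySet_of_crossing (hM : IsMulticover G X N C) {x y a b c d : V}
    (hx : x ∈ X) (hy : y ∈ X) (hxy : x ≠ y) (ha : a ∈ N x) (hb : b ∈ N y) (hc : c ∈ C)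
    (hd : d ∈ C) (hcd : G.Adj c d) (hac : G.Adj a c) (had : ¬G.Adj a d) (hbd : G.Adj b d)
    (hbc : ¬G.Adj b c) (hab : ¬G.Adj a b) :
    IsOdditySet G X N C {x, a, c, d, b, y} := by
  have h1 := hM.adj hx ha
  have h2 := hM.adj hy hb
  have h3 := (hM.avoids_neighbors hx hy hxy hb).2
  have h4 := (hM.avoids_neighbors hy hx hxy.symm ha).2
  have h5 := hM.not_adj hx hy
  have h6 := (hM.avoids_set hx hc).2
  have h7 := (hM.avoids_set hx hd).2
  have h8 := (hM.avoids_set hy hc).2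
  have h9 := (hM.avoids_set hy hd).2
  obtain ⟨f, hf⟩ := exists_embedding_eq_of_adj_iff (G := G) (Or.inr rfl) ![x, a, c, d, b, y] (by
    intro i j
    fin_cases i <;> fin_cases j <;> simp [h1, h2, h3, h4, h5, h6, h7, h8, h9, h1.symm, h2.symm,
      hcd, hcd.symm, hac, hac.symm, had, hbd, hbd.symm, hbc, hab, mt G.adj_symm h3,
      mt G.adj_symm h4, mt G.adj_symm h5, mt G.adj_symm h6, mt G.adj_symm h7, mt G.adj_symm h8,
      mt G.adj_symm h9, mt G.adj_symm had, mt G.adj_symm hbc, mt G.adj_symm hab])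
  have hrange : Set.range f = {x, a, c, d, b, y} := by
    rw [hf]; ext; simp [eq_comm]; tauto
  refine ⟨5, f, ⟨Or.inr rfl, ?_, ?_, ?_, ?_⟩, hrange⟩
  · simpa [hf] using hx
  · have : f (Fin.last 5) = y := by rw [hf]; rfl
    rwa [this]
  · intro z hz hz0 hzl
    replace hz0 : z ≠ x := by simpa [hf] using hz0
    replace hzl : z ≠ y := by
      have : f (Fin.last 5) = y := by rw [hf]; rfl
      rwa [this] at hzl
    have ha' := hM.avoids_neighbors hz hx hz0 ha
    have hb' := hM.avoids_neighbors hz hy hzl hb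
    have hc' := hM.avoids_set hz hc
    have hd' := hM.avoids_set hz hd
    rw [hrange]
    simp [hz0, hzl, ha', hb', hc', hd', hM.not_adj hz hx, hM.not_adj hz hy]
  · rw [hrange]
    have haU : a ∈ ⋃ x ∈ X, N x := Set.mem_biUnion (t := N) hx ha
    have hbU : b ∈ ⋃ x ∈ X, N x := Set.mem_biUnion (t := N) hy hb
    rintro v (rfl | rfl | rfl | rfl | rfl | rfl)
    exacts [Or.inl (Or.inl hx), Or.inl (Or.inr haU), Or.inr hc, Or.inr hd, Or.inl (Or.inr hbU),
      Or.inl (Or.inl hy)]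

end OdditySet

theorem exists_forall_subset_or_forall_subset {ι α : Type*} [Finite α] {K : Finset ι}
    (hK : K.Nonempty) (A B : ι → Set α)
    (h : ∀ c ∈ K, ∀ d ∈ K, A c ⊆ A d ∨ B d ⊆ B c) :
    ∃ c ∈ K, (∀ d ∈ K, A c ⊆ A d) ∨ ∀ d ∈ K, B c ⊆ B d := by
  obtain ⟨c, hc, hmin⟩ := K.exists_min_image (fun c => (A c).ncard) hK
  refine ⟨c, hc, ?_⟩
  by_contra! hcon
  obtain ⟨⟨d, hd, hcd⟩, e, he, hce⟩ := hcon
  have heq : ∀ u ∈ K, A u ⊆ A c → A u = A c := fun u hu huc =>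
    Set.eq_of_subset_of_ncard_le huc (hmin u hu)
  have hec := heq e he ((h e he c hc).resolve_right hce)
  have hde := (h e he d hd).resolve_left (hec ▸ hcd)
  have hcd' := (h d hd c hc).resolve_left fun hdc => hcd (heq d hd hdc).ge
  exact hce (hcd'.trans hde)

theorem CliqueControlled.exists_isOdditySet [Finite V] {G : SimpleGraph V} {κ τ : ℕ}
    {X : Finset V} {N : V → Set V} {C S T : Set V} {x y : V} {K : Finset V}
    (hG : CliqueControlled G κ τ) (hM : IsMulticover G X N C) (hx : x ∈ X) (hy : y ∈ X)
    (hxy : x ≠ y) (hKC : ↑K ⊆ C) (hK : G.IsNClique κ K) (hS : S ⊆ N x) (hT : T ⊆ N y)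
    (hcS : ∀ c ∈ K, ∃ a ∈ S, G.Adj a c) (hcT : ∀ c ∈ K, ∃ b ∈ T, G.Adj b c)
    (hST : ∀ a ∈ S, ∀ b ∈ T, ¬G.Adj a b) :
    ∃ P, IsOdditySet G X N C P ∧ P ⊆ {x, y} ∪ S ∪ T ∪ ↑K := by
  have : Nonempty V := ⟨x⟩
  by_contra! hcon
  obtain ⟨c, hc, hmin⟩ := exists_forall_subset_or_forall_subset (hG.nonempty_of_isNClique hK)
    (fun c => {a ∈ S | G.Adj a c}) (fun c => {b ∈ T | G.Adj b c}) (by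
      intro c hc d hd
      by_contra! hnot
      obtain ⟨⟨a, ⟨haS, hac⟩, had⟩, b, ⟨hbT, hbd⟩, hbc⟩ :=
        hnot.imp Set.not_subset.1 Set.not_subset.1
      replace had : ¬G.Adj a d := fun h => had ⟨haS, h⟩
      replace hbc : ¬G.Adj b c := fun h => hbc ⟨hbT, h⟩
      have hcd : G.Adj c d := hK.isClique hc hd fun e => had (e ▸ hac)
      refine hcon _ (hM.isOdditySet_of_crossing hx hy hxy (hS haS) (hT hbT) (hKC hc) (hKC hd) hcd
        hac had hbd hbc (hST a haS b hbT)) ?_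
      rintro v (rfl | rfl | rfl | rfl | rfl | rfl)
      · simp
      · simp [haS]
      · simp [Finset.mem_coe.1 hc]
      · simp [Finset.mem_coe.1 hd]
      · simp [hbT]
      · simp)
  rcases hmin with h | h
  · obtain ⟨a, haS, hac⟩ := hcS c hc
    exact hG.not_forall_adj hK a fun d hd => (h d hd ⟨haS, hac⟩).2
  · obtain ⟨b, hbT, hbc⟩ := hcT c hc
    exact hG.not_forall_adj hK b fun d hd => (h d hd ⟨hbT, hbc⟩).2

open Classical in
/-- The indices `x ∈ X` for which `c` has a neighbour in `N x` with no neighbour in `K`. -/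
noncomputable def privateIndices (G : SimpleGraph V) (X : Finset V) (N : V → Set V) (K : Finset V)
    (c : V) : Finset V :=
  X.filter fun x => ∃ a ∈ N x, G.Adj a c ∧ ∀ k ∈ K, ¬G.Adj a k

theorem mem_privateIndices {G : SimpleGraph V} {X : Finset V} {N : V → Set V} {K : Finset V}
    {c x : V} : x ∈ privateIndices G X N K c ↔
      x ∈ X ∧ ∃ a ∈ N x, G.Adj a c ∧ ∀ k ∈ K, ¬G.Adj a k := by
  simp [privateIndices]

theorem CliqueControlled.exists_isNClique_privateIndices [Finite V] {G : SimpleGraph V}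
    {κ τ p s : ℕ} {X : Finset V} {N : V → Set V} {C : Set V} (hG : CliqueControlled G κ τ)
    (hM : IsMulticover G X N C) (hX : 16 * (κ * p + 1) ≤ X.card)
    (hC : ¬ColorableOn G C (τ + 2 ^ X.card * (s + X.card * τ))) :
    ∃ K : Finset V, ↑K ⊆ C ∧ G.IsNClique κ K ∧
      ¬ColorableOn G {c ∈ C | p ≤ (privateIndices G X N K c).card} s := by
  classical
  by_contra! hcon
  have : Nonempty V := by
    obtain ⟨x, -⟩ := Finset.card_pos.1 (show 0 < X.card by omega)
    exact ⟨x⟩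
  let ι := {K : Finset V // ↑K ⊆ C ∧ G.IsNClique κ K}
  have : Fintype ι := Fintype.ofFinite ι
  have : Nonempty ι := by
    obtain ⟨K, hK⟩ := hG.exists_isNClique fun h => hC (h.mono subset_rfl (Nat.le_add_right _ _))
    exact ⟨⟨K, hK⟩⟩
  let A : V → ι → Set V := fun z K => {a ∈ N z | ∃ k ∈ K.1, G.Adj a k}
  obtain ⟨F, hFcard, hF⟩ := exists_dominating_finset X (κ * p + 1) hX fun z K => (A z K).ncard
  have hpick : ∀ z (K : ι), ∃ a, z ∈ X → a ∈ A z K := by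
    intro z K
    by_cases hz : z ∈ X
    · obtain ⟨k, hk⟩ := hG.nonempty_of_isNClique K.2.2
      obtain ⟨a, ha, hak⟩ := hM.exists_adj hz (K.2.1 hk)
      exact ⟨a, fun _ => ⟨ha, k, hk, hak⟩⟩
    · exact ⟨z, fun h => absurd h hz⟩
  choose a ha using hpick
  let U : ι → Set V := fun K => {c ∈ C | p ≤ (privateIndices G X N K.1 c).card} ∪
    ⋃ z ∈ X, G.neighborSet (a z K)
  have hU : ColorableOn G (⋃ K ∈ F, U K) (2 ^ X.card * (s + X.card * τ)) :=
    (ColorableOn.biUnion fun K _ => (hcon K.1 K.2.1 K.2.2).union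
      (ColorableOn.biUnion fun z _ => hG.colorableOn_neighborSet _)).mono subset_rfl
      (Nat.mul_le_mul_right _ hFcard)
  obtain ⟨K, hKsub, hK⟩ := hG.exists_isNClique (ColorableOn.diff hU hC)
  obtain ⟨L, hLF, hL⟩ := hF ⟨K, fun k hk => (hKsub hk).1, hK⟩
  have hLU : ∀ k ∈ K, k ∈ C ∧ k ∉ U L := fun k hk =>
    ⟨(hKsub hk).1, fun h => (hKsub hk).2 (Set.mem_biUnion hLF h)⟩
  have hbad : (K.biUnion fun k => privateIndices G X N L.1 k).card ≤ κ * p := by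
    refine (Finset.card_biUnion_le_card_mul K _ p fun k hk => ?_).trans_eq
      (congrArg (· * p) hK.card_eq)
    by_contra! hlt
    exact (hLU k hk).2 (Or.inl ⟨(hLU k hk).1, hlt.le⟩)
  obtain ⟨z, hz, hzbad⟩ := Finset.exists_mem_notMem_of_card_lt_card
    (lt_of_lt_of_le (Nat.lt_succ_of_le hbad) hL)
  obtain ⟨hzX, hrank⟩ := Finset.mem_filter.1 hz
  have hsub : A z ⟨K, fun k hk => (hKsub hk).1, hK⟩ ⊆ A z L := by
    rintro b ⟨hb, k, hk, hbk⟩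
    by_contra hnot
    refine hzbad (Finset.mem_biUnion.2 ⟨k, hk, mem_privateIndices.2 ⟨hzX, b, hb, hbk, ?_⟩⟩)
    exact fun l hl hbl => hnot ⟨hb, l, hl, hbl⟩
  have heq := Set.eq_of_subset_of_ncard_le hsub hrank
  obtain ⟨-, k, hk, hak⟩ := heq.symm ▸ ha z L hzX
  exact (hLU k hk).2 (Or.inr (Set.mem_biUnion (Finset.mem_coe.2 hzX) hak))

/-- The multicover has an oddity which is anticomplete to a multicover of length `m`, contained in
the given one, of a set that is not `c`-colourable. -/
def HasSeparatedOddity (G : SimpleGraph V) (X : Finset V) (N : V → Set V) (C : Set V)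
    (m c : ℕ) : Prop :=
  ∃ (P : Set V) (X' : Finset V) (N' : V → Set V) (C' : Set V),
    IsOdditySet G X N C P ∧ IsMulticover G X' N' C' ∧ X' ⊆ X ∧ (∀ x ∈ X', N' x ⊆ N x) ∧
    C' ⊆ C ∧ X'.card = m ∧ ¬ColorableOn G C' c ∧
    Anticomplete G P ((↑X' : Set V) ∪ (⋃ x ∈ X', N' x) ∪ C')

theorem HasSeparatedOddity.mono {G : SimpleGraph V} {X X' : Finset V} {N N' : V → Set V}
    {C C' : Set V} {m c : ℕ} (h : HasSeparatedOddity G X' N' C' m c) (hM : IsMulticover G X N C)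
    (hX : X' ⊆ X) (hN : ∀ x ∈ X', N' x ⊆ N x) (hC : C' ⊆ C) : HasSeparatedOddity G X N C m c := by
  obtain ⟨P, Y, L, D, hP, hM', hY, hL, hD, h⟩ := h
  exact ⟨P, Y, L, D, hP.mono hM hX hN hC, hM', hY.trans hX,
    fun x hx => (hL x hx).trans (hN x (hY hx)), hD.trans hC, h⟩

theorem exists_nonempty_of_not_colorableOn {G : SimpleGraph V} {S : Set V} {n : ℕ}
    (h : ¬ColorableOn G S n) : S.Nonempty := by
  rw [Set.nonempty_iff_ne_empty]
  rintro rfl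
  exact h ⟨fun _ => 0, by simp, by simp⟩

theorem CliqueControlled.hasSeparatedOddity [Finite V] {G : SimpleGraph V} {κ τ m c : ℕ}
    {X : Finset V} {N : V → Set V} {C : Set V} (hG : CliqueControlled G κ τ)
    (hM : IsMulticover G X N C) (hX : 16 * (κ * (m + 2) + 1) ≤ X.card)
    (hC : ¬ColorableOn G C
      (τ + 2 ^ X.card * (2 ^ X.card * c + κ * (τ + X.card * τ) + X.card * τ)))
    (hN : ∀ x ∈ X, ∀ y ∈ X, x ≠ y → ∀ a ∈ N x, ∀ b ∈ N y, ¬G.Adj a b) :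
    HasSeparatedOddity G X N C m c := by
  classical
  obtain ⟨K, hKC, hK, hW⟩ := hG.exists_isNClique_privateIndices hM hX hC
  have hpick : ∀ z k, ∃ a, z ∈ X → k ∈ K → a ∈ N z ∧ G.Adj a k := by
    intro z k
    by_cases h : z ∈ X ∧ k ∈ K
    · obtain ⟨a, ha⟩ := hM.exists_adj h.1 (hKC h.2)
      exact ⟨a, fun _ _ => ha⟩
    · exact ⟨z, fun hz hk => absurd ⟨hz, hk⟩ h⟩
  choose a ha using hpick
  let R : Set V := ⋃ k ∈ K, (G.neighborSet k ∪ ⋃ z ∈ X, G.neighborSet (a z k))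
  have hR : ColorableOn G R (κ * (τ + X.card * τ)) := by
    rw [← hK.card_eq]
    exact ColorableOn.biUnion fun k _ => (hG.colorableOn_neighborSet k).union
      (ColorableOn.biUnion fun z _ => hG.colorableOn_neighborSet _)
  obtain ⟨T, hTX, hT⟩ := ColorableOn.exists_fiber (s := X.powerset) (privateIndices G X N K)
    (fun v _ => Finset.mem_powerset.2 (Finset.filter_subset _ _))
    (by rw [Finset.card_powerset]; exact ColorableOn.diff hR hW)
  rw [Finset.mem_powerset] at hTX
  set C' : Set V :=
    {v ∈ {c ∈ C | m + 2 ≤ (privateIndices G X N K c).card} \ R | privateIndices G X N K v = T}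
  have hTcard : m + 2 ≤ T.card := by
    obtain ⟨v, ⟨⟨-, hv⟩, -⟩, rfl⟩ := exists_nonempty_of_not_colorableOn hT
    exact hv
  obtain ⟨x, hx, y, hy, hxy⟩ := Finset.one_lt_card.1 (show 1 < T.card by omega)
  obtain ⟨X', hX'T, hX'card⟩ := Finset.exists_subset_card_eq
    (show m ≤ ((T.erase x).erase y).card by
      rw [Finset.card_erase_of_mem (Finset.mem_erase.2 ⟨hxy.symm, hy⟩),
        Finset.card_erase_of_mem hx]
      omega)
  have hX' : ∀ z ∈ X', z ∈ T ∧ z ∈ X ∧ z ≠ x ∧ z ≠ y := by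
    intro z hz
    obtain ⟨hzy, hzx, hzT⟩ := by simpa using hX'T hz
    exact ⟨hzT, hTX hzT, hzx, hzy⟩
  let N' : V → Set V := fun z => {u ∈ N z | ∀ k ∈ K, ¬G.Adj u k}
  have hC'C : C' ⊆ C := fun v hv => hv.1.1.1
  have hC'K : ∀ v ∈ C', ∀ k ∈ K, ¬G.Adj k v ∧ ∀ z ∈ X, ¬G.Adj (a z k) v := by
    intro v hv k hk
    exact ⟨fun h => hv.1.2 (Set.mem_biUnion (Finset.mem_coe.2 hk) (Or.inl h)),
      fun z hz h => hv.1.2 (Set.mem_biUnion (Finset.mem_coe.2 hk)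
        (Or.inr (Set.mem_biUnion (Finset.mem_coe.2 hz) h)))⟩
  have hM' : IsMulticover G X' N' C' := by
    refine hM.restrict (fun z hz => (hX' z hz).2.1) (fun z _ u hu => hu.1) hC'C ?_
    intro z hz v hv
    obtain ⟨-, u, hu, huv, huK⟩ := mem_privateIndices.1 (hv.2.symm ▸ (hX' z hz).1)
    exact ⟨u, ⟨hu, huK⟩, huv⟩
  have hxX := hTX hx
  have hyX := hTX hy
  have hsub : ∀ z ∈ X, (a z '' ↑K) ⊆ N z := by
    rintro z hz _ ⟨k, hk, rfl⟩
    exact (ha z k hz hk).1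
  obtain ⟨P, hP, hPsub⟩ := hG.exists_isOdditySet hM hxX hyX hxy hKC hK (hsub x hxX) (hsub y hyX)
    (fun k hk => ⟨a x k, Set.mem_image_of_mem _ hk, (ha x k hxX hk).2⟩)
    (fun k hk => ⟨a y k, Set.mem_image_of_mem _ hk, (ha y k hyX hk).2⟩)
    (fun u hu v hv => hN x hxX y hyX hxy u (hsub x hxX hu) v (hsub y hyX hv))
  refine ⟨P, X', N', C', hP, hM', fun z hz => (hX' z hz).2.1, fun z _ u hu => hu.1, hC'C,
    hX'card, hT, anticomplete_iff.2 fun v hv u hu => ?_⟩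
  have hends : ∀ w ∈ X, (∀ z ∈ X', z ≠ w) → w ≠ u ∧ ¬G.Adj w u := by
    intro w hw hwX'
    rcases hu with (hu | hu) | hu
    · exact ⟨(hwX' u hu).symm, hM.not_adj hw (hX' u hu).2.1⟩
    · obtain ⟨z, hz, huz⟩ := Set.mem_iUnion₂.1 hu
      exact hM.avoids_neighbors hw (hX' z hz).2.1 (hwX' z hz).symm huz.1
    · exact hM.avoids_set hw (hC'C hu)
  have hmid : ∀ w ∈ X, (∀ z ∈ X', z ≠ w) → ∀ k ∈ K, a w k ≠ u ∧ ¬G.Adj (a w k) u := by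
    intro w hw hwX' k hk
    have hak := (ha w k hw hk).1
    rcases hu with (hu | hu) | hu
    · have h := hM.avoids_neighbors (hX' u hu).2.1 hw (hwX' u hu) hak
      exact ⟨h.1.symm, fun e => h.2 e.symm⟩
    · obtain ⟨z, hz, huz⟩ := Set.mem_iUnion₂.1 hu
      exact ⟨hM.neighbors_ne hw (hX' z hz).2.1 (hwX' z hz).symm hak huz.1,
        hN w hw z (hX' z hz).2.1 (hwX' z hz).symm _ hak u huz.1⟩
    · exact ⟨hM.neighbors_ne_set hw hak (hC'C hu), (hC'K u hu k hk).2 w hw⟩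
  rcases hPsub hv with ((hv | hv) | hv) | hv
  · rcases hv with rfl | rfl
    · exact hends v hxX fun z hz => (hX' z hz).2.2.1
    · exact hends v hyX fun z hz => (hX' z hz).2.2.2
  · obtain ⟨k, hk, rfl⟩ := hv
    exact hmid x hxX (fun z hz => (hX' z hz).2.2.1) k hk
  · obtain ⟨k, hk, rfl⟩ := hv
    exact hmid y hyX (fun z hz => (hX' z hz).2.2.2) k hk
  · rcases hu with (hu | hu) | hu
    · have h := hM.avoids_set (hX' u hu).2.1 (hKC hv)
      exact ⟨h.1.symm, fun e => h.2 e.symm⟩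
    · obtain ⟨z, hz, huz⟩ := Set.mem_iUnion₂.1 hu
      exact ⟨(hM.neighbors_ne_set (hX' z hz).2.1 huz.1 (hKC hv)).symm,
        fun e => huz.2 v hv e.symm⟩
    · refine ⟨?_, (hC'K u hu v hv).1⟩
      rintro rfl
      exact (hC'K v hu v hv).2 x hxX (ha x v hxX hv).2

/-- An edge between two of the sets `N x` gives either an oddity separated from a large part of the
multicover, or a large part of the multicover lying in the neighbourhood of a single vertex. -/
theorem CliqueControlled.hasSeparatedOddity_or_exists_neighborSet {G : SimpleGraph V}
    {κ τ m m' c : ℕ} {X : Finset V} {N : V → Set V} {C : Set V} (hG : CliqueControlled G κ τ)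
    (hM : IsMulticover G X N C) (hX : m + 2 * m' + 2 ≤ X.card)
    (hC : ¬ColorableOn G C (2 ^ X.card * 2 ^ X.card * c + (τ + τ))) {x y a b : V} (hx : x ∈ X)
    (hy : y ∈ X) (hxy : x ≠ y) (ha : a ∈ N x) (hb : b ∈ N y) (hab : G.Adj a b) :
    HasSeparatedOddity G X N C m c ∨
      ∃ v ∈ ⋃ x ∈ X, N x, ∃ (X' : Finset V) (N' : V → Set V) (C' : Set V),
        IsMulticover G X' N' C' ∧ X' ⊆ X ∧ (∀ x ∈ X', N' x ⊆ N x ∩ G.neighborSet v) ∧ C' ⊆ C ∧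
        X'.card = m' ∧ ¬ColorableOn G C' c := by
  classical
  let Y := (X.erase x).erase y
  have hY : Y.card + 2 = X.card := by
    rw [Finset.card_erase_of_mem (Finset.mem_erase.2 ⟨hxy.symm, hy⟩),
      Finset.card_erase_of_mem hx]
    omega
  have hYX : ∀ z ∈ Y, z ∈ X ∧ z ≠ x ∧ z ≠ y := by
    intro z hz
    obtain ⟨hzy, hzx, hzX⟩ := by simpa [Y] using hz
    exact ⟨hzX, hzx, hzy⟩
  let t : V → V → Finset V := fun v w => X.filter fun z => ∃ u ∈ N z, G.Adj u w ∧ G.Adj v u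
  obtain ⟨⟨S, T⟩, -, hST⟩ := ColorableOn.exists_fiber (s := X.powerset ×ˢ X.powerset)
    (fun w => (t a w, t b w))
    (fun w _ => Finset.mem_product.2 ⟨Finset.mem_powerset.2 (Finset.filter_subset _ _),
      Finset.mem_powerset.2 (Finset.filter_subset _ _)⟩)
    (by
      rw [Finset.card_product, Finset.card_powerset]
      exact ColorableOn.diff ((hG.colorableOn_neighborSet a).union (hG.colorableOn_neighborSet b))
        hC)
  set C' : Set V :=
    {w ∈ C \ (G.neighborSet a ∪ G.neighborSet b) | (t a w, t b w) = (S, T)}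
  have hC'C : C' ⊆ C := fun w hw => hw.1.1
  have hlarge : ∀ v ∈ ⋃ x ∈ X, N x, ∀ R : Finset V, (∀ w ∈ C', t v w = R) → m' ≤ R.card →
      ∃ v ∈ ⋃ x ∈ X, N x, ∃ (X' : Finset V) (N' : V → Set V) (C' : Set V),
        IsMulticover G X' N' C' ∧ X' ⊆ X ∧ (∀ x ∈ X', N' x ⊆ N x ∩ G.neighborSet v) ∧ C' ⊆ C ∧
        X'.card = m' ∧ ¬ColorableOn G C' c := by
    intro v hv R hR hm
    obtain ⟨X', hX'R, hX'⟩ := Finset.exists_subset_card_eq hm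
    obtain ⟨w, hw⟩ := exists_nonempty_of_not_colorableOn hST
    have hX'X : X' ⊆ X := hX'R.trans (hR w hw ▸ Finset.filter_subset _ _)
    refine ⟨v, hv, X', fun z => N z ∩ G.neighborSet v, C', ?_, hX'X, fun z _ => subset_rfl, hC'C,
      hX', hST⟩
    refine hM.restrict hX'X (fun z _ => Set.inter_subset_left) hC'C fun z hz w hw => ?_
    obtain ⟨-, u, hu, huw, hvu⟩ := Finset.mem_filter.1 (hR w hw ▸ hX'R hz)
    exact ⟨u, ⟨hu, hvu⟩, huw⟩
  by_cases hS : m' ≤ S.card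
  · exact Or.inr (hlarge a (Set.mem_biUnion (t := N) hx ha) S
      (fun w hw => (Prod.mk.inj hw.2).1) hS)
  by_cases hT : m' ≤ T.card
  · exact Or.inr (hlarge b (Set.mem_biUnion (t := N) hy hb) T
      (fun w hw => (Prod.mk.inj hw.2).2) hT)
  obtain ⟨X', hX'Y, hX'card⟩ := Finset.exists_subset_card_eq (show m ≤ (Y \ (S ∪ T)).card by
    have h1 := Finset.le_card_sdiff (S ∪ T) Y
    have h2 := Finset.card_union_le S T
    omega)
  have hX' : ∀ z ∈ X', (z ∈ X ∧ z ≠ x ∧ z ≠ y) ∧ z ∉ S ∧ z ∉ T := by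
    intro z hz
    obtain ⟨hzY, hzST⟩ := Finset.mem_sdiff.1 (hX'Y hz)
    exact ⟨hYX z hzY, by simpa using hzST⟩
  refine Or.inl ⟨{x, a, b, y}, X', fun z => {u ∈ N z | ¬G.Adj a u ∧ ¬G.Adj b u}, C',
    hM.isOdditySet_of_adj hx hy hxy ha hb hab, ?_, fun z hz => (hX' z hz).1.1,
    fun z _ u hu => hu.1, hC'C, hX'card, hST, anticomplete_iff.2 ?_⟩
  · refine hM.restrict (fun z hz => (hX' z hz).1.1) (fun z _ u hu => hu.1) hC'C fun z hz w hw => ?_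
    obtain ⟨⟨hzX, -⟩, hzS, hzT⟩ := hX' z hz
    obtain ⟨u, hu, huw⟩ := hM.exists_adj hzX (hC'C hw)
    obtain ⟨rfl, rfl⟩ := Prod.mk.inj hw.2
    exact ⟨u, ⟨hu, fun h => hzS (Finset.mem_filter.2 ⟨hzX, u, hu, huw, h⟩),
      fun h => hzT (Finset.mem_filter.2 ⟨hzX, u, hu, huw, h⟩)⟩, huw⟩
  have hends : ∀ w ∈ X, (∀ z ∈ X', z ≠ w) →
      ∀ u ∈ (↑X' : Set V) ∪ (⋃ z ∈ X', {u ∈ N z | ¬G.Adj a u ∧ ¬G.Adj b u}) ∪ C',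
        w ≠ u ∧ ¬G.Adj w u := by
    rintro w hw hwX' u ((hu | hu) | hu)
    · exact ⟨(hwX' u hu).symm, hM.not_adj hw (hX' u hu).1.1⟩
    · obtain ⟨z, hz, huz⟩ := Set.mem_iUnion₂.1 hu
      exact hM.avoids_neighbors hw (hX' z hz).1.1 (hwX' z hz).symm huz.1
    · exact hM.avoids_set hw (hC'C hu)
  have hmid : ∀ w ∈ X, (∀ z ∈ X', z ≠ w) → ∀ v ∈ N w, (v = a ∨ v = b) →
      ∀ u ∈ (↑X' : Set V) ∪ (⋃ z ∈ X', {u ∈ N z | ¬G.Adj a u ∧ ¬G.Adj b u}) ∪ C',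
        v ≠ u ∧ ¬G.Adj v u := by
    rintro w hw hwX' v hv hvab u ((hu | hu) | hu)
    · have h := hM.avoids_neighbors (hX' u hu).1.1 hw (hwX' u hu) hv
      exact ⟨h.1.symm, fun e => h.2 e.symm⟩
    · obtain ⟨z, hz, huz, hua, hub⟩ := Set.mem_iUnion₂.1 hu
      refine ⟨hM.neighbors_ne hw (hX' z hz).1.1 (hwX' z hz).symm hv huz, ?_⟩
      rcases hvab with rfl | rfl <;> assumption
    · refine ⟨hM.neighbors_ne_set hw hv (hC'C hu), fun h => hu.1.2 ?_⟩
      rcases hvab with rfl | rfl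
      exacts [Or.inl h, Or.inr h]
  have hx' : ∀ z ∈ X', z ≠ x := fun z hz => (hX' z hz).1.2.1
  have hy' : ∀ z ∈ X', z ≠ y := fun z hz => (hX' z hz).1.2.2
  rintro v (rfl | rfl | rfl | rfl)
  exacts [hends v hx hx', hmid x hx hx' v ha (Or.inl rfl), hmid y hy hy' v hb (Or.inr rfl),
    hends v hy hy']

/-- The multicover has `n` pairwise anticomplete oddities. -/
def HasOddities (G : SimpleGraph V) (X : Finset V) (N : V → Set V) (C : Set V) (n : ℕ) : Prop :=
  ∃ P : Fin n → Set V, (∀ i, IsOdditySet G X N C (P i)) ∧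
    Pairwise fun i j => Anticomplete G (P i) (P j)

theorem HasOddities.mono {G : SimpleGraph V} {X X' : Finset V} {N N' : V → Set V}
    {C C' : Set V} {n : ℕ} (h : HasOddities G X' N' C' n) (hM : IsMulticover G X N C)
    (hX : X' ⊆ X) (hN : ∀ x ∈ X', N' x ⊆ N x) (hC : C' ⊆ C) : HasOddities G X N C n := by
  obtain ⟨P, hP, hanti⟩ := h
  exact ⟨P, fun i => (hP i).mono hM hX hN hC, hanti⟩

theorem HasSeparatedOddity.hasOddities_succ {G : SimpleGraph V} {X : Finset V} {N : V → Set V}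
    {C : Set V} {m c n : ℕ} (h : HasSeparatedOddity G X N C m c) (hM : IsMulticover G X N C)
    (hn : ∀ X' N' C', IsMulticover G X' N' C' → X'.card = m → ¬ColorableOn G C' c →
      HasOddities G X' N' C' n) : HasOddities G X N C (n + 1) := by
  obtain ⟨P, X', N', C', hP, hM', hX, hN, hC, hcard, hcol, hanti⟩ := h
  obtain ⟨Q, hQ, hQanti⟩ := hn X' N' C' hM' hcard hcol
  have hPQ : ∀ i, Anticomplete G P (Q i) := fun i => anticomplete_iff.2 fun u hu v hv =>
    anticomplete_iff.1 hanti u hu v ((hQ i).subset hv)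
  refine ⟨Fin.cons P Q, Fin.cases hP fun i => (hQ i).mono hM hX hN hC, fun i j hij => ?_⟩
  induction i using Fin.cases with
  | zero =>
    induction j using Fin.cases with
    | zero => exact absurd rfl hij
    | succ j => exact hPQ j
  | succ i =>
    induction j using Fin.cases with
    | zero => exact (hPQ i).symm
    | succ j => exact hQanti fun h => hij (congrArg Fin.succ h)

/-- The induction behind `stmt8`: `n` oddities exist under the additional assumption that the sets
`N x` together include no clique on `l` vertices. -/
theorem exists_forall_hasOddities (τ κ n l : ℕ) :
    ∃ m c : ℕ, ∀ (V : Type) [Finite V] (G : SimpleGraph V) (X : Finset V) (N : V → Set V)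
      (C : Set V), CliqueControlled G κ τ → IsMulticover G X N C → X.card = m →
      ¬ColorableOn G C c → (∀ K : Finset V, ↑K ⊆ ⋃ x ∈ X, N x → ¬G.IsNClique l K) →
      HasOddities G X N C n := by
  induction n generalizing l with
  | zero => exact ⟨0, 0, fun V _ G X N C _ _ _ _ _ => ⟨Fin.elim0, Fin.rec0, Fin.rec0⟩⟩
  | succ n ihn =>
  induction l with
  | zero => exact ⟨0, 0, fun V _ G X N C _ _ _ _ h => absurd (by simp) (h ∅ (by simp))⟩
  | succ l ihl =>
  classical
  obtain ⟨m₁, c₁, h₁⟩ := ihn (κ + 1)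
  obtain ⟨m₂, c₂, h₂⟩ := ihl
  let p := 16 * (κ * (m₁ + 2) + 1)
  let m := p + (m₁ + 2 * m₂ + 2)
  let c := max (τ + 2 ^ p * (2 ^ p * c₁ + κ * (τ + p * τ) + p * τ))
    (2 ^ m * 2 ^ m * max c₁ c₂ + (τ + τ))
  refine ⟨m, c, fun V _ G X N C hG hM hX hC hl => ?_⟩
  have hn : ∀ X' N' C', IsMulticover G X' N' C' → X'.card = m₁ → ¬ColorableOn G C' c₁ →
      HasOddities G X' N' C' n := fun X' N' C' hM' hX' hC' =>
    h₁ V G X' N' C' hG hM' hX' hC' fun K _ hK => hG.1 K hK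
  by_cases hN : ∀ x ∈ X, ∀ y ∈ X, x ≠ y → ∀ a ∈ N x, ∀ b ∈ N y, ¬G.Adj a b
  · obtain ⟨Y, hYX, hY⟩ := Finset.exists_subset_card_eq (show p ≤ X.card by omega)
    have hM' : IsMulticover G Y N C := hM.restrict hYX (fun _ _ => subset_rfl) subset_rfl
      fun x hx v hv => hM.exists_adj (hYX hx) hv
    have hsep : HasSeparatedOddity G Y N C m₁ c₁ := hG.hasSeparatedOddity hM' hY.ge
      (by rw [hY]; exact fun h => hC (h.mono subset_rfl (le_max_left _ _)))
      fun x hx y hy => hN x (hYX hx) y (hYX hy)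
    exact (hsep.hasOddities_succ hM' hn).mono hM hYX (fun _ _ => subset_rfl) subset_rfl
  · push Not at hN
    obtain ⟨x, hx, y, hy, hxy, a, ha, b, hb, hab⟩ := hN
    rcases hG.hasSeparatedOddity_or_exists_neighborSet (m := m₁) (m' := m₂) (c := max c₁ c₂) hM
      (by omega) (by rw [hX]; exact fun h => hC (h.mono subset_rfl (le_max_right _ _)))
      hx hy hxy ha hb hab with hsep | ⟨v, hv, X', N', C', hM', hX', hN', hC', hcard, hcol⟩
    · exact hsep.hasOddities_succ hM fun X' N' C' hM' hX' hC' =>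
        hn X' N' C' hM' hX' fun h => hC' (h.mono subset_rfl (le_max_left _ _))
    · refine (h₂ V G X' N' C' hG hM' hcard
        (fun h => hcol (h.mono subset_rfl (le_max_right _ _))) fun K hKN hK => ?_).mono hM hX'
        (fun z hz => (hN' z hz).trans Set.inter_subset_left) hC'
      have hKN' : ∀ u ∈ K, u ∈ (⋃ x ∈ X, N x) ∧ G.Adj v u := by
        intro u hu
        obtain ⟨z, hz, huz⟩ := Set.mem_iUnion₂.1 (hKN hu)
        exact ⟨Set.mem_biUnion (t := N) (hX' hz) (hN' z hz huz).1, (hN' z hz huz).2⟩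
      refine hl (insert v K) (fun u hu => ?_) (hK.insert fun u hu => (hKN' u hu).2)
      rcases Finset.mem_insert.1 (Finset.mem_coe.1 hu) with rfl | hu
      exacts [hv, (hKN' u hu).1]

theorem stmt8 (τ κ : ℕ) :
    ∃ m c : ℕ, ∀ (V : Type) [Fintype V] (G : SimpleGraph V)
      (X : Finset V) (N : V → Set V) (C : Set V),
      G.cliqueNum ≤ κ →
      (∀ Y : Set V, (G.induce Y).cliqueNum < κ →
        (G.induce Y).chromaticNumber ≤ (τ : ℕ∞)) →
      IsStableMulticover G X N C → X.card = m →
      (c : ℕ∞) < (G.induce C).chromaticNumber →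
      ∃ (k₁ k₂ k₃ : ℕ) (f₁ : pathGraph (k₁ + 1) ↪g G) (f₂ : pathGraph (k₂ + 1) ↪g G)
        (f₃ : pathGraph (k₃ + 1) ↪g G),
        IsOddity G X N C f₁ ∧ IsOddity G X N C f₂ ∧ IsOddity G X N C f₃ ∧
        Anticomplete G (Set.range f₁) (Set.range f₂) ∧
        Anticomplete G (Set.range f₁) (Set.range f₃) ∧
        Anticomplete G (Set.range f₂) (Set.range f₃) := by
  obtain ⟨m, c, h⟩ := exists_forall_hasOddities τ κ 3 (κ + 1)
  refine ⟨m, c, fun V _ G X N C hω hχ hM hX hC => ?_⟩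
  have hG := CliqueControlled.of_cliqueNum hω hχ
  obtain ⟨P, hP, hanti⟩ := h V G X N C hG hM.1 hX
    (by rw [colorableOn_iff, ← chromaticNumber_le_iff_colorable]; exact hC.not_ge)
    fun K _ hK => hG.1 K hK
  obtain ⟨k₁, f₁, h₁, e₁⟩ := hP 0
  obtain ⟨k₂, f₂, h₂, e₂⟩ := hP 1
  obtain ⟨k₃, f₃, h₃, e₃⟩ := hP 2
  refine ⟨k₁, k₂, k₃, f₁, f₂, f₃, h₁, h₂, h₃, ?_⟩
  rw [e₁, e₂, e₃]
  exact ⟨hanti (by decide), hanti (by decide), hanti (by decide)⟩
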